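/- (Steady rank two flows are point sources.) Let U ⊆ E be a nonempty open connected set, and let (V, p) be a smooth STEADY solution of the incompressible Euler equations on U (V and p independent of t) with fixed straight streamlines given by a unit direction field n. Suppose that for every x ∈ U the linear map fderiv ℝ n x has rank 2. Then there exist c ∈ E and constants H₀, p₀ ∈ ℝ such that for all x ∈ U, V x = (H₀ / ‖x − c‖³) • (x − c) and p x = p₀ − H₀² / (2 ‖x − c‖⁴); that is, the streamlines are the normals to a round sphere centred at c. -/

import Mathlib

open scoped RealInnerProductSpace

noncomputable section

abbrev E3 := EuclideanSpace ℝ (Fin 3)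

/-- The divergence of a vector field `W` at `x`: the trace of its derivative. -/
def vecDiv (W : E3 → E3) (x : E3) : ℝ :=
  LinearMap.trace ℝ E3 (fderiv ℝ W x : E3 →ₗ[ℝ] E3)

/-- `(V, p)` is a smooth steady (time-independent) solution of the incompressible
Euler equations on `U`. -/
def SolvesEulerSteady (U : Set E3) (V : E3 → E3) (p : E3 → ℝ) : Prop :=
  ContDiffOn ℝ (⊤ : ℕ∞) V U ∧ ContDiffOn ℝ (⊤ : ℕ∞) p U ∧
  ∀ x ∈ U, fderiv ℝ V x (V x) = - gradient p x ∧ vecDiv V x = 0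

/-- The steady flow `V` has straight streamlines with unit direction field `n`. -/
def StraightStreamlinesSteady (U : Set E3) (V : E3 → E3) (n : E3 → E3) : Prop :=
  ContDiffOn ℝ (⊤ : ℕ∞) n U ∧ (∀ x ∈ U, ‖n x‖ = 1) ∧
  (∃ f : E3 → ℝ, ContDiffOn ℝ (⊤ : ℕ∞) f U ∧ ∀ x ∈ U, 0 < f x ∧ V x = f x • n x) ∧
  ∀ x ∈ U, fderiv ℝ n x (n x) = 0

open Topology Filter

/-- The trace as a continuous linear functional on endomorphisms. -/
def trC : (E3 →L[ℝ] E3) →L[ℝ] ℝ :=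
  LinearMap.toContinuousLinearMap
    (LinearMap.trace ℝ E3 ∘ₗ ContinuousLinearMap.coeLM (R := ℝ) (M := E3) (N₃ := E3) ℝ)

lemma trC_apply (A : E3 →L[ℝ] E3) : trC A = LinearMap.trace ℝ E3 (A : E3 →ₗ[ℝ] E3) := rfl

lemma trC_comp_comm (A B : E3 →L[ℝ] E3) : trC (A.comp B) = trC (B.comp A) := by
  simp only [trC_apply, ContinuousLinearMap.toLinearMap_comp]
  exact LinearMap.trace_mul_comm ℝ (A : E3 →ₗ[ℝ] E3) (B : E3 →ₗ[ℝ] E3)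

/-- An orthonormal frame whose last vector is `n`. -/
structure IsFrame (e₁ e₂ n : E3) : Prop where
  h11 : ⟪e₁, e₁⟫ = 1
  h22 : ⟪e₂, e₂⟫ = 1
  h33 : ⟪n, n⟫ = 1
  h12 : ⟪e₁, e₂⟫ = 0
  h21 : ⟪e₂, e₁⟫ = 0
  h13 : ⟪e₁, n⟫ = 0
  h31 : ⟪n, e₁⟫ = 0
  h23 : ⟪e₂, n⟫ = 0
  h32 : ⟪n, e₂⟫ = 0
  expand : ∀ v : E3, v = ⟪e₁, v⟫ • e₁ + ⟪e₂, v⟫ • e₂ + ⟪n, v⟫ • n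
  trace : ∀ B : E3 →L[ℝ] E3, trC B = ⟪e₁, B e₁⟫ + ⟪e₂, B e₂⟫ + ⟪n, B n⟫

lemma exists_isFrame {n : E3} (hn : ‖n‖ = 1) : ∃ e₁ e₂, IsFrame e₁ e₂ n := by
  have horth : Orthonormal ℝ (({2} : Set (Fin 3)).domRestrict (fun _ => n)) := by
    constructor
    · intro i; simpa using hn
    · intro i j hij
      exact absurd (Subsingleton.elim i j) hij
  obtain ⟨b, hb⟩ := Orthonormal.exists_orthonormalBasis_extension_of_card_eq
    (𝕜 := ℝ) (E := E3) (ι := Fin 3) (by simp) horth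
  have hb2 : b 2 = n := hb 2 rfl
  have ho := fun i j => orthonormal_iff_ite.mp b.orthonormal i j
  subst hb2
  refine ⟨b 0, b 1, by simp, by simp, by simp, by simp [ho], by simp [ho],
    by simp [ho], by simp [ho], by simp [ho], by simp [ho], fun v => ?_, fun B => ?_⟩
  · have := b.sum_repr' v
    rw [Fin.sum_univ_three] at this
    exact this.symm
  · rw [trC_apply, LinearMap.trace_eq_sum_inner _ b, Fin.sum_univ_three]
    rfl

/-- In an adapted frame, an endomorphism killing `n` with range orthogonal to `n` is given by
a two by two matrix. -/
lemma IsFrame.matrix {e₁ e₂ n : E3} (F : IsFrame e₁ e₂ n) {A : E3 →L[ℝ] E3}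
    (hr : ∀ v, ⟪n, A v⟫ = 0) :
    ∃ a b c d : ℝ, A e₁ = a • e₁ + b • e₂ ∧ A e₂ = c • e₁ + d • e₂ := by
  refine ⟨⟪e₁, A e₁⟫, ⟪e₂, A e₁⟫, ⟪e₁, A e₂⟫, ⟪e₂, A e₂⟫, ?_, ?_⟩
  · have := F.expand (A e₁)
    rwa [hr, zero_smul, add_zero] at this
  · have := F.expand (A e₂)
    rwa [hr, zero_smul, add_zero] at this

lemma det_ne_zero_of_rank_two {n : E3} (hn : ‖n‖ = 1) {A : E3 →L[ℝ] E3} (hA : A n = 0)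
    (hr : ∀ v, ⟪n, A v⟫ = 0) (hrank : LinearMap.rank (A : E3 →ₗ[ℝ] E3) = 2) :
    trC A ^ 2 - trC (A.comp A) ≠ 0 := by
  obtain ⟨e₁, e₂, F⟩ := exists_isFrame hn
  obtain ⟨a, b, c, d, h1, h2⟩ := F.matrix hr
  have hfin : Module.finrank ℝ (LinearMap.range (A : E3 →ₗ[ℝ] E3)) = 2 := by
    rw [Module.finrank]
    have : Module.rank ℝ (LinearMap.range (A : E3 →ₗ[ℝ] E3)) = 2 := hrank
    rw [this]; simp
  have hker : Module.finrank ℝ (LinearMap.ker (A : E3 →ₗ[ℝ] E3)) = 1 := by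
    have := LinearMap.finrank_range_add_finrank_ker (A : E3 →ₗ[ℝ] E3)
    rw [hfin] at this
    simp at this
    omega
  have hn0 : n ≠ 0 := by
    rintro rfl; simp at hn
  have key : ∀ s t : ℝ, A (s • e₁ + t • e₂) = 0 → s = 0 ∧ t = 0 := by
    intro s t hst
    have := (finrank_eq_one_iff_of_nonzero' (K := ℝ)
      (⟨n, hA⟩ : LinearMap.ker (A : E3 →ₗ[ℝ] E3))
      (by simpa [Subtype.ext_iff] using hn0)).1 hker ⟨s • e₁ + t • e₂, hst⟩
    obtain ⟨r, hr⟩ := this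
    have hr' : r • n = s • e₁ + t • e₂ := congrArg Subtype.val hr
    have i1 := congrArg (fun w => ⟪e₁, w⟫) hr'
    have i2 := congrArg (fun w => ⟪e₂, w⟫) hr'
    simp only [inner_add_right, inner_smul_right, F.h11, F.h12, F.h13, F.h21, F.h22, F.h23] at i1 i2
    constructor <;> linarith
  intro h0
  simp only [F.trace, ContinuousLinearMap.comp_apply, h1, h2, hA, map_add, map_smul,
    inner_add_right, inner_smul_right, F.h11, F.h12, F.h21, F.h22, inner_zero_right, map_zero] at h0
  have hdet : a * d - b * c = 0 := by linarith
  have k1 := key d (-b) (by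
    simp only [map_add, map_smul, h1, h2]
    have : d • (a • e₁ + b • e₂) + (-b) • (c • e₁ + d • e₂) = (a * d - b * c) • e₁ := by module
    rw [this, hdet, zero_smul])
  have k2 := key (-c) a (by
    simp only [map_add, map_smul, h1, h2]
    have : (-c) • (a • e₁ + b • e₂) + a • (c • e₁ + d • e₂) = (a * d - b * c) • e₂ := by module
    rw [this, hdet, zero_smul])
  have k3 := key 1 0 (by
    simp [h1, k2.2, neg_eq_zero.1 k1.2])
  exact one_ne_zero k3.1

lemma trace_cube {n : E3} (hn : ‖n‖ = 1) {A : E3 →L[ℝ] E3} (hA : A n = 0)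
    (hr : ∀ v, ⟪n, A v⟫ = 0) :
    2 * trC ((A.comp A).comp A) = trC A * (3 * trC (A.comp A) - trC A ^ 2) := by
  obtain ⟨e₁, e₂, F⟩ := exists_isFrame hn
  obtain ⟨a, b, c, d, h1, h2⟩ := F.matrix hr
  simp only [F.trace, ContinuousLinearMap.comp_apply, h1, h2, hA, map_add, map_smul,
    inner_add_right, inner_smul_right, F.h11, F.h12, F.h21, F.h22, inner_zero_right, map_zero]
  ring

lemma symm_of_symm_tangent {n : E3} (hn : ‖n‖ = 1) {A : E3 →L[ℝ] E3} (hA : A n = 0)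
    (hr : ∀ v, ⟪n, A v⟫ = 0)
    (hs : ∀ u v, ⟪n, u⟫ = 0 → ⟪n, v⟫ = 0 → ⟪A u, v⟫ = ⟪A v, u⟫) (u v : E3) :
    ⟪A u, v⟫ = ⟪A v, u⟫ := by
  have hnn : ⟪n, n⟫ = 1 := by rw [real_inner_self_eq_norm_sq, hn]; norm_num
  have hr' : ∀ v, ⟪A v, n⟫ = 0 := fun v => by rw [real_inner_comm, hr]
  have := hs (u - ⟪n, u⟫ • n) (v - ⟪n, v⟫ • n)
    (by rw [inner_sub_right, inner_smul_right, hnn]; ring)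
    (by rw [inner_sub_right, inner_smul_right, hnn]; ring)
  simpa [inner_sub_right, inner_smul_right, hA, hr'] using this

/-- The second derivative of a direction field with constant principal curvatures, away from
umbilic points. -/
lemma second_deriv_formula {n : E3} (hn : ‖n‖ = 1) {A : E3 →L[ℝ] E3} (hA : A n = 0)
    (hr : ∀ v, ⟪n, A v⟫ = 0) (hs : ∀ u v, ⟪A u, v⟫ = ⟪A v, u⟫)
    {S : E3 →L[ℝ] E3 →L[ℝ] E3} (hS : ∀ u v, S u v = S v u)
    (hS' : ∀ u v w, ⟪S u v, w⟫ = ⟪S u w, v⟫) (hSn : ∀ u, S u n = - A (A u))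
    (ht1 : ∀ u, ⟪n, u⟫ = 0 → trC (S u) = 0)
    (ht2 : ∀ u, ⟪n, u⟫ = 0 → trC ((S u).comp A) = 0)
    (hne : 2 * trC (A.comp A) - trC A ^ 2 ≠ 0) (u v w : E3) :
    ⟪S u v, w⟫ = -(⟪n, u⟫ * ⟪A v, A w⟫ + ⟪n, v⟫ * ⟪A u, A w⟫ + ⟪n, w⟫ * ⟪A u, A v⟫) := by
  obtain ⟨e₁, e₂, F⟩ := exists_isFrame hn
  obtain ⟨a, b, c, d, h1, h2⟩ := F.matrix hr
  have hbc : c = b := by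
    have := hs e₁ e₂
    simp only [h1, h2, inner_add_left, inner_smul_left, F.h11, F.h12, F.h21, F.h22] at this
    simp at this
    linarith
  subst hbc
  set R : E3 → E3 → E3 → ℝ := fun u v w => ⟪S u v, w⟫ +
    (⟪n, u⟫ * ⟪A v, A w⟫ + ⟪n, v⟫ * ⟪A u, A w⟫ + ⟪n, w⟫ * ⟪A u, A v⟫) with hR
  have s12 : ∀ u v w, R u v w = R v u w := by
    intro u v w
    simp only [hR, hS u v, real_inner_comm (A u) (A v)]
    ring
  have s23 : ∀ u v w, R u v w = R u w v := by
    intro u v w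
    simp only [hR, hS' u v w, real_inner_comm (A w) (A v)]
    ring
  have l3 : ∀ u v (r s t : ℝ), R u v (r • e₁ + s • e₂ + t • n)
      = r * R u v e₁ + s * R u v e₂ + t * R u v n := by
    intro u v r s t
    simp only [hR, map_add, map_smul, inner_add_right, inner_smul_right]
    ring
  have z3 : ∀ u v, R u v n = 0 := by
    intro u v
    rw [s23]
    simp only [hR, hSn, hA, inner_zero_right, inner_zero_left, F.h33, inner_neg_left]
    rw [hs (A u) v, real_inner_comm (A u) (A v)]
    ring
  have tR : ∀ u, ⟪n, u⟫ = 0 → R u e₁ e₁ + R u e₂ e₂ = 0 ∧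
      a * R u e₁ e₁ + 2 * c * R u e₁ e₂ + d * R u e₂ e₂ = 0 := by
    intro u hu
    have q1 := ht1 u hu
    have q2 := ht2 u hu
    have q3 : ⟪n, S u n⟫ = 0 := by rw [hSn, inner_neg_right, hr, neg_zero]
    have q4 := hS' u e₁ e₂
    rw [F.trace] at q1 q2
    simp only [ContinuousLinearMap.comp_apply, h1, h2, hA, map_add, map_smul, map_zero, q3,
      inner_add_right, inner_smul_right, inner_zero_right,
      fun x y z : E3 => real_inner_comm (S x y) z] at q1 q2
    simp only [hR, hu, F.h31, F.h32]
    constructor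
    · linarith
    · rw [q4] at *
      linarith
  obtain ⟨r1, r2⟩ := tR e₁ F.h31
  obtain ⟨r3, r4⟩ := tR e₂ F.h32
  rw [s12 e₂ e₁ e₁, s23 e₁ e₂ e₁] at r3 r4
  rw [s12 e₂ e₁ e₂] at r4
  clear_value R
  have hdisc : (a - d) ^ 2 + 4 * c ^ 2 ≠ 0 := by
    intro h0
    apply hne
    simp only [F.trace, ContinuousLinearMap.comp_apply, h1, h2, hA, map_add, map_smul,
      inner_add_right, inner_smul_right, F.h11, F.h12, F.h21, F.h22, inner_zero_right, map_zero]
    linarith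
  have e111 : R e₁ e₁ e₁ = 0 := by
    apply (mul_eq_zero.1 _).resolve_left hdisc
    linear_combination (a - d) * (r2 - d * r1) - 2 * c * (r4 - d * r3 - 2 * c * r1)
  have e112 : R e₁ e₁ e₂ = 0 := by
    apply (mul_eq_zero.1 _).resolve_left hdisc
    linear_combination 2 * c * (r2 - d * r1) + (a - d) * (r4 - d * r3 - 2 * c * r1)
  have e122 : R e₁ e₂ e₂ = 0 := by linarith
  have e222 : R e₂ e₂ e₂ = 0 := by linarith
  have h3 : ∀ u v w, R u v e₁ = 0 → R u v e₂ = 0 → R u v w = 0 := by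
    intro u v w k1 k2
    rw [F.expand w, l3, k1, k2, z3]
    ring
  have : R u v w = 0 := by
    have a11 : ∀ u, R u e₁ e₁ = 0 := fun u => by
      rw [s12, s23]
      exact h3 _ _ _ e111 e112
    have a12 : ∀ u, R u e₁ e₂ = 0 := fun u => by
      rw [s12, s23]
      exact h3 _ _ _ ((s23 _ _ _).trans e112) e122
    have a22 : ∀ u, R u e₂ e₂ = 0 := fun u => by
      rw [s12, s23]
      exact h3 _ _ _ ((s23 _ _ _).trans ((s12 _ _ _).trans e122)) e222
    have a1 : ∀ u v, R u v e₁ = 0 := fun u v => by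
      rw [s23]
      exact h3 _ _ _ (a11 u) (a12 u)
    have a2 : ∀ u v, R u v e₂ = 0 := fun u v => by
      rw [s23]
      exact h3 _ _ _ ((s23 _ _ _).trans (a12 u)) (a22 u)
    exact h3 _ _ _ (a1 u v) (a2 u v)
  rw [hR] at this
  linarith

lemma umbilic_of_compat {n : E3} (hn : ‖n‖ = 1) {A : E3 →L[ℝ] E3} (hA : A n = 0)
    (hr : ∀ v, ⟪n, A v⟫ = 0) (hs : ∀ u v, ⟪A u, v⟫ = ⟪A v, u⟫)
    (hdet : trC A ^ 2 - trC (A.comp A) ≠ 0)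
    (hc : ∀ u v w z, ⟪n, u⟫ = 0 → ⟪n, v⟫ = 0 → ⟪n, w⟫ = 0 → ⟪n, z⟫ = 0 →
      ⟪A v, A w⟫ * ⟪A u, z⟫ + ⟪A u, w⟫ * ⟪A v, A z⟫
        = ⟪A u, A w⟫ * ⟪A v, z⟫ + ⟪A v, w⟫ * ⟪A u, A z⟫) :
    2 * trC (A.comp A) - trC A ^ 2 = 0 := by
  obtain ⟨e₁, e₂, F⟩ := exists_isFrame hn
  obtain ⟨a, b, c, d, h1, h2⟩ := F.matrix hr
  have hbc := hs e₁ e₂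
  have c1 := hc e₁ e₂ e₁ e₁ F.h31 F.h32 F.h31 F.h31
  have c2 := hc e₁ e₂ e₁ e₂ F.h31 F.h32 F.h31 F.h32
  simp only [F.trace, ContinuousLinearMap.comp_apply, h1, h2, hA, map_add, map_smul,
    inner_add_right, inner_smul_right, inner_add_left, real_inner_smul_left, F.h11, F.h12, F.h21,
    F.h22, inner_zero_right, map_zero] at hdet c1 c2 hbc ⊢
  have hbc' : c = b := by linarith
  subst hbc'
  have hd : a * d - c * c ≠ 0 := fun h => hdet (by linarith)
  have k1 : c = 0 := by
    apply (mul_eq_zero.1 _).resolve_left hd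
    linarith
  have k2 : a - d = 0 := by
    apply (mul_eq_zero.1 _).resolve_left hd
    subst k1
    linarith
  subst k1
  have : a = d := by linarith
  subst this
  ring

lemma eq_smul_of_umbilic {n : E3} (hn : ‖n‖ = 1) {A : E3 →L[ℝ] E3} (hA : A n = 0)
    (hr : ∀ v, ⟪n, A v⟫ = 0) (hs : ∀ u v, ⟪A u, v⟫ = ⟪A v, u⟫)
    (hu : 2 * trC (A.comp A) - trC A ^ 2 = 0) (v : E3) :
    A v = (trC A / 2) • (v - ⟪n, v⟫ • n) := by
  obtain ⟨e₁, e₂, F⟩ := exists_isFrame hn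
  obtain ⟨a, b, c, d, h1, h2⟩ := F.matrix hr
  have hbc := hs e₁ e₂
  have hτ : trC A = a + d := by
    simp only [F.trace, h1, h2, hA, inner_add_right, inner_smul_right, F.h11, F.h12, F.h21, F.h22,
      inner_zero_right]
    ring
  rw [hτ] at hu ⊢
  simp only [F.trace, ContinuousLinearMap.comp_apply, h1, h2, hA, map_add, map_smul,
    inner_add_right, inner_smul_right, inner_add_left, real_inner_smul_left, F.h11, F.h12, F.h21,
    F.h22, inner_zero_right, map_zero] at hu hbc
  have hbc' : c = b := by linarith
  subst hbc'
  have k1 : c = 0 := by nlinarith [sq_nonneg (a - d), sq_nonneg c]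
  have k2 : d = a := by nlinarith [sq_nonneg (a - d), sq_nonneg c]
  subst k1 k2
  have := F.expand v
  have h3 : v - ⟪n, v⟫ • n = ⟪e₁, v⟫ • e₁ + ⟪e₂, v⟫ • e₂ := by
    rw [sub_eq_iff_eq_add]; exact this
  rw [h3]
  conv_lhs => rw [this]
  simp only [map_add, map_smul, h1, h2, hA]
  module

lemma fderiv_congr_of_eqOn {F G : Type*} [NormedAddCommGroup F] [NormedSpace ℝ F]
    [NormedAddCommGroup G] [NormedSpace ℝ G] {U : Set F} (hU : IsOpen U) {g h : F → G}
    (hgh : ∀ x ∈ U, g x = h x) {x : F} (hx : x ∈ U) : fderiv ℝ g x = fderiv ℝ h x :=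
  Filter.EventuallyEq.fderiv_eq (Filter.eventually_of_mem (hU.mem_nhds hx) hgh)

lemma second_fderiv_symm {F : Type*} [NormedAddCommGroup F] [NormedSpace ℝ F] {h : E3 → F}
    {x : E3} (hh : ContDiffAt ℝ (⊤ : ℕ∞) h x) (u v : E3) :
    fderiv ℝ (fderiv ℝ h) x u v = fderiv ℝ (fderiv ℝ h) x v u :=
  hh.isSymmSndFDerivAt (by
    rw [minSmoothness_of_isRCLikeNormedField]; exact WithTop.coe_le_coe.2 le_top) u v

/-- A continuous function vanishing where `k` does not vanish is zero, provided that `k` vanishes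
identically near no point. -/
lemma eq_zero_of_eq_zero_of_ne {U : Set E3} (hU : IsOpen U) {F k : E3 → ℝ}
    (hF : ContinuousOn F U) (hk : ∀ x ∈ U, ¬ ∀ᶠ y in 𝓝 x, k y = 0)
    (h : ∀ x ∈ U, k x ≠ 0 → F x = 0) : ∀ x ∈ U, F x = 0 := by
  intro x hx
  by_contra hne
  have hc : ContinuousAt F x := hF.continuousAt (hU.mem_nhds hx)
  refine hk x hx ?_
  filter_upwards [hc.eventually_ne hne, hU.mem_nhds hx] with y hy hyU
  by_contra hky
  exact hy (h y hyU hky)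

/-- If the gradient of `h` is `k • n`, then the mixed second derivatives of `h` give a
compatibility relation for `k` and `n`. -/
lemma compat_of_fderiv_eq {U : Set E3} (hU : IsOpen U) {h k : E3 → ℝ} {n : E3 → E3}
    (hh : ContDiffOn ℝ (⊤ : ℕ∞) h U) (hk : ContDiffOn ℝ (⊤ : ℕ∞) k U)
    (hn : ContDiffOn ℝ (⊤ : ℕ∞) n U)
    (heq : ∀ x ∈ U, ∀ v, fderiv ℝ h x v = k x * ⟪n x, v⟫) {x : E3} (hx : x ∈ U) (u v : E3) :
    fderiv ℝ k x u * ⟪n x, v⟫ + k x * ⟪fderiv ℝ n x u, v⟫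
      = fderiv ℝ k x v * ⟪n x, u⟫ + k x * ⟪fderiv ℝ n x v, u⟫ := by
  have hxU := hU.mem_nhds hx
  have hk' := ((hk.contDiffAt hxU).differentiableAt (by simp)).hasFDerivAt
  have hn' := ((hn.contDiffAt hxU).differentiableAt (by simp)).hasFDerivAt
  have hd : DifferentiableAt ℝ (fderiv ℝ h) x :=
    ((hh.fderiv_of_isOpen (m := (⊤ : ℕ∞)) hU (by simp)).contDiffAt hxU).differentiableAt (by simp)
  have key : ∀ u v, fderiv ℝ (fderiv ℝ h) x u v
      = fderiv ℝ k x u * ⟪n x, v⟫ + k x * ⟪fderiv ℝ n x u, v⟫ := by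
    intro u v
    have e1 := (hd.hasFDerivAt.clm_apply (hasFDerivAt_const v x)).fderiv
    have e2 := (hk'.mul (hn'.inner ℝ (hasFDerivAt_const v x))).fderiv
    have e3 := fderiv_congr_of_eqOn hU (fun y hy => heq y hy v) hx
    have e4 := congrArg (fun L => L u) (e1.symm.trans (e3.trans e2))
    simp [fderivInnerCLM_apply] at e4
    rw [e4]; ring
  rw [← key, ← key]
  exact second_fderiv_symm (hh.contDiffAt hxU) u v

/-- A smooth unit field with straight integral curves whose derivative has rank two. -/
structure RankTwoField (U : Set E3) (n : E3 → E3) : Prop where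
  isOpen : IsOpen U
  smooth : ContDiffOn ℝ (⊤ : ℕ∞) n U
  unit : ∀ x ∈ U, ‖n x‖ = 1
  geodesic : ∀ x ∈ U, fderiv ℝ n x (n x) = 0
  rank : ∀ x ∈ U, LinearMap.rank (fderiv ℝ n x : E3 →ₗ[ℝ] E3) = 2

/-- The mean curvature (up to a factor) of a field. -/
def tau (n : E3 → E3) (x : E3) : ℝ := trC (fderiv ℝ n x)

/-- The trace of the square of the derivative of a field. -/
def sig (n : E3 → E3) (x : E3) : ℝ := trC ((fderiv ℝ n x).comp (fderiv ℝ n x))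

namespace RankTwoField

variable {U : Set E3} {n : E3 → E3} (H : RankTwoField U n)
include H

lemma hasFDerivAt {x : E3} (hx : x ∈ U) : HasFDerivAt n (fderiv ℝ n x) x :=
  ((H.smooth.contDiffAt (H.isOpen.mem_nhds hx)).differentiableAt (by simp)).hasFDerivAt

lemma smooth_fderiv : ContDiffOn ℝ (⊤ : ℕ∞) (fderiv ℝ n) U :=
  H.smooth.fderiv_of_isOpen H.isOpen (by simp)

lemma hasFDerivAt_fderiv {x : E3} (hx : x ∈ U) :
    HasFDerivAt (fderiv ℝ n) (fderiv ℝ (fderiv ℝ n) x) x :=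
  ((H.smooth_fderiv.contDiffAt (H.isOpen.mem_nhds hx)).differentiableAt (by simp)).hasFDerivAt

lemma smooth_tau : ContDiffOn ℝ (⊤ : ℕ∞) (tau n) U :=
  trC.contDiff.comp_contDiffOn H.smooth_fderiv

lemma smooth_sig : ContDiffOn ℝ (⊤ : ℕ∞) (sig n) U :=
  trC.contDiff.comp_contDiffOn (H.smooth_fderiv.clm_comp H.smooth_fderiv)

lemma inner_self {x : E3} (hx : x ∈ U) : ⟪n x, n x⟫ = 1 := by
  rw [real_inner_self_eq_norm_sq, H.unit x hx]; norm_num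

lemma inner_fderiv {x : E3} (hx : x ∈ U) (v : E3) : ⟪n x, fderiv ℝ n x v⟫ = 0 := by
  have e1 := ((H.hasFDerivAt hx).inner ℝ (H.hasFDerivAt hx)).fderiv
  have e2 := fderiv_congr_of_eqOn H.isOpen (fun y hy => H.inner_self hy) hx
  have e3 := congrArg (fun L => L v) (e1.symm.trans e2)
  simp [fderivInnerCLM_apply, real_inner_comm (n x)] at e3
  exact e3

lemma second_fderiv_apply_self {x : E3} (hx : x ∈ U) (u : E3) :
    fderiv ℝ (fderiv ℝ n) x u (n x) = - fderiv ℝ n x (fderiv ℝ n x u) := by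
  have e1 := ((H.hasFDerivAt_fderiv hx).clm_apply (H.hasFDerivAt hx)).fderiv
  have e2 := fderiv_congr_of_eqOn H.isOpen (fun y hy => H.geodesic y hy) hx
  have e3 := congrArg (fun L => L u) (e1.symm.trans e2)
  simp at e3
  exact eq_neg_of_add_eq_zero_right e3

lemma second_fderiv_symm {x : E3} (hx : x ∈ U) (u v : E3) :
    fderiv ℝ (fderiv ℝ n) x u v = fderiv ℝ (fderiv ℝ n) x v u :=
  _root_.second_fderiv_symm (H.smooth.contDiffAt (H.isOpen.mem_nhds hx)) u v

lemma second_fderiv_self {x : E3} (hx : x ∈ U) :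
    fderiv ℝ (fderiv ℝ n) x (n x) = - (fderiv ℝ n x).comp (fderiv ℝ n x) := by
  ext1 v
  rw [H.second_fderiv_symm hx, H.second_fderiv_apply_self hx]
  rfl

lemma fderiv_tau {x : E3} (hx : x ∈ U) (v : E3) :
    fderiv ℝ (tau n) x v = trC (fderiv ℝ (fderiv ℝ n) x v) := by
  have : HasFDerivAt (tau n) (trC.comp (fderiv ℝ (fderiv ℝ n) x)) x :=
    trC.hasFDerivAt.comp x (H.hasFDerivAt_fderiv hx)
  rw [this.fderiv]; rfl

lemma fderiv_sig {x : E3} (hx : x ∈ U) (v : E3) :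
    fderiv ℝ (sig n) x v = 2 * trC ((fderiv ℝ (fderiv ℝ n) x v).comp (fderiv ℝ n x)) := by
  have : HasFDerivAt (sig n) _ x :=
    trC.hasFDerivAt.comp x ((H.hasFDerivAt_fderiv hx).clm_comp (H.hasFDerivAt_fderiv hx))
  rw [this.fderiv]
  simp only [ContinuousLinearMap.comp_apply, add_apply, map_add,
    ContinuousLinearMap.compL_apply, ContinuousLinearMap.flip_apply]
  rw [trC_comp_comm]; ring

lemma fderiv_tau_self {x : E3} (hx : x ∈ U) : fderiv ℝ (tau n) x (n x) = - sig n x := by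
  rw [H.fderiv_tau hx, H.second_fderiv_self hx, map_neg]; rfl

lemma fderiv_sig_self {x : E3} (hx : x ∈ U) :
    fderiv ℝ (sig n) x (n x) = - (tau n x * (3 * sig n x - tau n x ^ 2)) := by
  rw [H.fderiv_sig hx, H.second_fderiv_self hx, ContinuousLinearMap.neg_comp, map_neg, mul_neg,
    trace_cube (H.unit x hx) (H.geodesic x hx) (H.inner_fderiv hx)]
  rfl

lemma det_ne_zero {x : E3} (hx : x ∈ U) : tau n x ^ 2 - sig n x ≠ 0 :=
  det_ne_zero_of_rank_two (H.unit x hx) (H.geodesic x hx) (H.inner_fderiv hx) (H.rank x hx)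

/-- The Jacobian `τ (4 τ² - 3 σ)` vanishes identically near no point. -/
lemma not_eventually_jacobian_eq_zero {x : E3} (hx : x ∈ U) :
    ¬ ∀ᶠ y in 𝓝 x, tau n y * (4 * tau n y ^ 2 - 3 * sig n y) = 0 := by
  intro h
  have h0 := h.self_of_nhds
  have hxU := H.isOpen.mem_nhds hx
  have dτ := ((H.smooth_tau.contDiffAt hxU).differentiableAt (by simp)).hasFDerivAt
  have dσ := ((H.smooth_sig.contDiffAt hxU).differentiableAt (by simp)).hasFDerivAt
  have e1 := (dτ.mul (((dτ.pow 2).const_mul 4).sub (dσ.const_mul 3))).fderiv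
  have e2 : fderiv ℝ (fun y => tau n y * (4 * tau n y ^ 2 - 3 * sig n y)) x
      = fderiv ℝ (fun _ => (0 : ℝ)) x := Filter.EventuallyEq.fderiv_eq h
  have e3 := congrArg (fun L => L (n x)) (e1.symm.trans e2)
  simp [H.fderiv_tau_self hx, H.fderiv_sig_self hx] at e3
  have hd := H.det_ne_zero hx
  generalize tau n x = t at *
  generalize sig n x = s at *
  rcases mul_eq_zero.1 h0 with ht | ht
  · subst ht
    apply hd
    have : s ^ 2 = 0 := by nlinarith
    nlinarith [pow_eq_zero_iff (two_ne_zero) |>.1 this]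
  · have hs : s = 4 / 3 * t ^ 2 := by linarith
    subst hs
    apply hd
    have : t ^ 4 = 0 := by nlinarith
    rw [pow_eq_zero_iff (by norm_num)] at this
    subst this; ring

end RankTwoField

/-- The scalar equations satisfied by the speed `f` and the pressure `p` of a steady flow along
the field `n`. -/
structure SteadyFlow (U : Set E3) (n : E3 → E3) (f p : E3 → ℝ) : Prop extends
    RankTwoField U n where
  smooth_speed : ContDiffOn ℝ (⊤ : ℕ∞) f U
  smooth_pressure : ContDiffOn ℝ (⊤ : ℕ∞) p U
  speed_pos : ∀ x ∈ U, 0 < f x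
  fderiv_speed : ∀ x ∈ U, fderiv ℝ f x (n x) = - (f x * tau n x)
  fderiv_pressure : ∀ x ∈ U, ∀ v, fderiv ℝ p x v = f x ^ 2 * tau n x * ⟪n x, v⟫

lemma RankTwoField.fderiv_of_fderiv_eq {U : Set E3} {n : E3 → E3} (H : RankTwoField U n)
    {h k : E3 → ℝ} (hh : ContDiffOn ℝ (⊤ : ℕ∞) h U) (hk : ContDiffOn ℝ (⊤ : ℕ∞) k U)
    (heq : ∀ x ∈ U, ∀ v, fderiv ℝ h x v = k x * ⟪n x, v⟫) {x : E3} (hx : x ∈ U) (v : E3) :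
    fderiv ℝ k x v = fderiv ℝ k x (n x) * ⟪n x, v⟫ := by
  have := compat_of_fderiv_eq H.isOpen hh hk H.smooth heq hx (n x) v
  rw [H.geodesic x hx, inner_zero_left, real_inner_comm (n x) (fderiv ℝ n x v),
    H.inner_fderiv hx, H.inner_self hx] at this
  linarith

lemma RankTwoField.continuousOn_fderiv_tangent {U : Set E3} {n : E3 → E3} (H : RankTwoField U n)
    {h : E3 → ℝ} (hh : ContDiffOn ℝ (⊤ : ℕ∞) h U) (v : E3) :
    ContinuousOn (fun x => fderiv ℝ h x (v - ⟪n x, v⟫ • n x)) U := by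
  have h1 : ContinuousOn (fderiv ℝ h) U :=
    (hh.fderiv_of_isOpen (m := (⊤ : ℕ∞)) H.isOpen (by simp)).continuousOn
  have h2 := H.smooth.continuousOn
  fun_prop

namespace SteadyFlow

variable {U : Set E3} {n : E3 → E3} {f p : E3 → ℝ} (H : SteadyFlow U n f p)
include H

lemma symm {x : E3} (hx : x ∈ U) (u v : E3) : ⟪fderiv ℝ n x u, v⟫ = ⟪fderiv ℝ n x v, u⟫ := by
  have hc : ContinuousOn (fun x => ⟪fderiv ℝ n x u, v⟫ - ⟪fderiv ℝ n x v, u⟫) U := by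
    have := H.smooth_fderiv.continuousOn
    fun_prop
  refine sub_eq_zero.1 (eq_zero_of_eq_zero_of_ne H.isOpen hc
    (fun x hx => H.not_eventually_jacobian_eq_zero hx) (fun y hy hk => ?_) x hx)
  have hτ : tau n y ≠ 0 := left_ne_zero_of_mul hk
  refine sub_eq_zero.2 (symm_of_symm_tangent (H.unit y hy) (H.geodesic y hy) (H.inner_fderiv hy)
    (fun u v hu hv => ?_) u v)
  have := compat_of_fderiv_eq H.isOpen H.smooth_pressure
    ((H.smooth_speed.pow 2).mul H.smooth_tau) H.smooth H.fderiv_pressure hy u v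
  rw [hu, hv, mul_zero, mul_zero, zero_add, zero_add] at this
  exact mul_left_cancel₀ (mul_ne_zero (pow_ne_zero 2 (H.speed_pos y hy).ne') hτ) this

lemma fderiv_tangent_of_jacobian_ne_zero {x : E3} (hx : x ∈ U)
    (hk : tau n x * (4 * tau n x ^ 2 - 3 * sig n x) ≠ 0) {w : E3} (hw : ⟪n x, w⟫ = 0) :
    fderiv ℝ f x w = 0 ∧ fderiv ℝ (tau n) x w = 0 ∧ fderiv ℝ (sig n) x w = 0 := by
  have D : ∀ {g : E3 → ℝ}, ContDiffOn ℝ (⊤ : ℕ∞) g U → ∀ {y}, y ∈ U →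
      HasFDerivAt g (fderiv ℝ g y) y := fun hg y hy =>
    ((hg.contDiffAt (H.isOpen.mem_nhds hy)).differentiableAt (by simp)).hasFDerivAt
  have sf := H.smooth_speed
  have sτ := H.smooth_tau
  have sσ := H.smooth_sig
  have s0 : ContDiffOn ℝ (⊤ : ℕ∞) (fun y => f y ^ 2 * tau n y) U := by fun_prop
  have s1 : ContDiffOn ℝ (⊤ : ℕ∞) (fun y => f y ^ 2 * (-2 * tau n y ^ 2 - sig n y)) U := by
    fun_prop
  have s2 : ContDiffOn ℝ (⊤ : ℕ∞)
      (fun y => f y ^ 2 * (3 * tau n y ^ 3 + 9 * (tau n y * sig n y))) U := by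
    fun_prop
  have d0 : ∀ y ∈ U, ∀ v, fderiv ℝ (fun y => f y ^ 2 * tau n y) y v
      = 2 * f y * fderiv ℝ f y v * tau n y + f y ^ 2 * fderiv ℝ (tau n) y v := by
    intro y hy v
    refine (congrArg (fun L => L v) (((D sf hy).pow 2).mul (D sτ hy)).fderiv).trans ?_
    simp; ring
  have d1 : ∀ y ∈ U, ∀ v, fderiv ℝ (fun y => f y ^ 2 * (-2 * tau n y ^ 2 - sig n y)) y v
      = 2 * f y * fderiv ℝ f y v * (-2 * tau n y ^ 2 - sig n y)
        + f y ^ 2 * (-4 * tau n y * fderiv ℝ (tau n) y v - fderiv ℝ (sig n) y v) := by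
    intro y hy v
    refine (congrArg (fun L => L v) (((D sf hy).pow 2).mul
      ((((D sτ hy).pow 2).const_mul (-2)).sub (D sσ hy))).fderiv).trans ?_
    simp; ring
  have d2 : ∀ y ∈ U, ∀ v,
      fderiv ℝ (fun y => f y ^ 2 * (3 * tau n y ^ 3 + 9 * (tau n y * sig n y))) y v
      = 2 * f y * fderiv ℝ f y v * (3 * tau n y ^ 3 + 9 * (tau n y * sig n y))
        + f y ^ 2 * (9 * tau n y ^ 2 * fderiv ℝ (tau n) y v
          + 9 * (fderiv ℝ (tau n) y v * sig n y + tau n y * fderiv ℝ (sig n) y v)) := by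
    intro y hy v
    refine (congrArg (fun L => L v) (((D sf hy).pow 2).mul ((((D sτ hy).pow 3).const_mul 3).add
      (((D sτ hy).mul (D sσ hy)).const_mul 9))).fderiv).trans ?_
    simp; ring
  have g0 : ∀ y ∈ U, ∀ v, fderiv ℝ (fun y => f y ^ 2 * tau n y) y v
      = f y ^ 2 * (-2 * tau n y ^ 2 - sig n y) * ⟪n y, v⟫ := by
    intro y hy v
    rw [H.fderiv_of_fderiv_eq H.smooth_pressure s0 H.fderiv_pressure hy v, d0 y hy,
      H.fderiv_speed y hy, H.fderiv_tau_self hy]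
    ring
  have g1 : ∀ y ∈ U, ∀ v, fderiv ℝ (fun y => f y ^ 2 * (-2 * tau n y ^ 2 - sig n y)) y v
      = f y ^ 2 * (3 * tau n y ^ 3 + 9 * (tau n y * sig n y)) * ⟪n y, v⟫ := by
    intro y hy v
    rw [H.fderiv_of_fderiv_eq s0 s1 g0 hy v, d1 y hy,
      H.fderiv_speed y hy, H.fderiv_tau_self hy, H.fderiv_sig_self hy]
    ring
  have E0 := g0 x hx w
  have E1 := g1 x hx w
  have E2 := H.fderiv_of_fderiv_eq s1 s2 g1 hx w
  rw [hw, mul_zero] at E0 E1 E2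
  rw [d0 x hx] at E0
  rw [d1 x hx] at E1
  rw [d2 x hx] at E2
  have hf := (H.speed_pos x hx).ne'
  generalize fderiv ℝ f x w = y at *
  generalize fderiv ℝ (tau n) x w = a at *
  generalize fderiv ℝ (sig n) x w = b at *
  generalize tau n x = t at *
  generalize sig n x = s at *
  generalize f x = q at *
  have hy : y = 0 := by
    apply (mul_eq_zero.1 _).resolve_left (mul_ne_zero hf hk)
    linear_combination (1 / 6) * E2 + (3 / 2) * t * E1 - (1 / 6) * (9 * s - 27 * t ^ 2) * E0
  subst hy
  have ha : a = 0 := by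
    apply (mul_eq_zero.1 _).resolve_left (pow_ne_zero 2 hf)
    linear_combination E0
  subst ha
  refine ⟨rfl, rfl, ?_⟩
  apply (mul_eq_zero.1 _).resolve_left (pow_ne_zero 2 hf)
  linear_combination -E1

lemma fderiv_eq_of_tangent {h : E3 → ℝ} (hh : ContDiffOn ℝ (⊤ : ℕ∞) h U)
    (h0 : ∀ x ∈ U, tau n x * (4 * tau n x ^ 2 - 3 * sig n x) ≠ 0 →
      ∀ w, ⟪n x, w⟫ = 0 → fderiv ℝ h x w = 0) {x : E3} (hx : x ∈ U) (v : E3) :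
    fderiv ℝ h x v = fderiv ℝ h x (n x) * ⟪n x, v⟫ := by
  have := eq_zero_of_eq_zero_of_ne H.isOpen (H.continuousOn_fderiv_tangent hh v)
    (fun x hx => H.not_eventually_jacobian_eq_zero hx) (fun y hy hk => h0 y hy hk _ (by
      rw [inner_sub_right, inner_smul_right, H.inner_self hy]; ring)) x hx
  rw [map_sub, map_smul, smul_eq_mul] at this
  linarith

lemma fderiv_speed_eq {x : E3} (hx : x ∈ U) (v : E3) :
    fderiv ℝ f x v = - (f x * tau n x) * ⟪n x, v⟫ := by
  rw [H.fderiv_eq_of_tangent H.smooth_speed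
    (fun x hx hk w hw => (H.fderiv_tangent_of_jacobian_ne_zero hx hk hw).1) hx, H.fderiv_speed x hx]

lemma fderiv_tau_eq {x : E3} (hx : x ∈ U) (v : E3) :
    fderiv ℝ (tau n) x v = - sig n x * ⟪n x, v⟫ := by
  rw [H.fderiv_eq_of_tangent H.smooth_tau
    (fun x hx hk w hw => (H.fderiv_tangent_of_jacobian_ne_zero hx hk hw).2.1) hx,
    H.fderiv_tau_self hx]

lemma fderiv_sig_tangent {x : E3} (hx : x ∈ U) {v : E3} (hv : ⟪n x, v⟫ = 0) :
    fderiv ℝ (sig n) x v = 0 := by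
  rw [H.fderiv_eq_of_tangent H.smooth_sig
    (fun x hx hk w hw => (H.fderiv_tangent_of_jacobian_ne_zero hx hk hw).2.2) hx, hv, mul_zero]

lemma fderiv_inner_fderiv {x : E3} (hx : x ∈ U) (u w z : E3) :
    fderiv ℝ (fun y => ⟪fderiv ℝ n y w, z⟫) x u = ⟪fderiv ℝ (fderiv ℝ n) x u w, z⟫ := by
  have := (((H.hasFDerivAt_fderiv hx).clm_apply (hasFDerivAt_const w x)).inner ℝ
    (hasFDerivAt_const z x)).fderiv
  rw [this]
  simp [fderivInnerCLM_apply]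

/-- The level surfaces of the pressure are totally umbilic. -/
lemma umbilic {x : E3} (hx : x ∈ U) : 2 * sig n x - tau n x ^ 2 = 0 := by
  by_contra hne
  have hxU := H.isOpen.mem_nhds hx
  have hnear : ∀ᶠ y in 𝓝 x, y ∈ U ∧ 2 * sig n y - tau n y ^ 2 ≠ 0 := by
    have h1 := (H.smooth_tau.continuousOn.continuousAt hxU)
    have h2 := (H.smooth_sig.continuousOn.continuousAt hxU)
    have h3 : ContinuousAt (fun y => 2 * sig n y - tau n y ^ 2) x := by fun_prop
    exact Filter.Eventually.and hxU (h3.eventually_ne hne)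
  have formula : ∀ v w z, ∀ᶠ y in 𝓝 x, fderiv ℝ (fun y => ⟪fderiv ℝ n y w, z⟫) y v
      = -(⟪n y, v⟫ * ⟪fderiv ℝ n y w, fderiv ℝ n y z⟫
        + ⟪n y, w⟫ * ⟪fderiv ℝ n y v, fderiv ℝ n y z⟫
        + ⟪n y, z⟫ * ⟪fderiv ℝ n y v, fderiv ℝ n y w⟫) := by
    intro v w z
    filter_upwards [hnear] with y hy
    obtain ⟨hyU, hy⟩ := hy
    rw [H.fderiv_inner_fderiv hyU]
    refine second_deriv_formula (H.unit y hyU) (H.geodesic y hyU) (H.inner_fderiv hyU)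
      (H.symm hyU) (H.second_fderiv_symm hyU) (fun u v w => ?_) (H.second_fderiv_apply_self hyU)
      (fun u hu => ?_) (fun u hu => ?_) hy v w z
    · rw [← H.fderiv_inner_fderiv hyU, ← H.fderiv_inner_fderiv hyU]
      rw [fderiv_congr_of_eqOn H.isOpen (fun y hy => H.symm hy v w) hyU]
    · rw [← H.fderiv_tau hyU, H.fderiv_tau_eq hyU, hu, mul_zero]
    · have := H.fderiv_sig_tangent hyU hu
      rw [H.fderiv_sig hyU] at this
      linarith
  refine hne (umbilic_of_compat (H.unit x hx) (H.geodesic x hx) (H.inner_fderiv hx) (H.symm hx)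
    (H.det_ne_zero hx) (fun u v w z hu hv hw hz => ?_))
  have hsm : ContDiffOn ℝ (⊤ : ℕ∞) (fun y => ⟪fderiv ℝ n y w, z⟫) U :=
    (H.smooth_fderiv.clm_apply contDiffOn_const).inner ℝ contDiffOn_const
  have hd : DifferentiableAt ℝ (fderiv ℝ (fun y => ⟪fderiv ℝ n y w, z⟫)) x :=
    ((hsm.fderiv_of_isOpen (m := (⊤ : ℕ∞)) H.isOpen (by simp)).contDiffAt hxU).differentiableAt
      (by simp)
  have A : ∀ v, HasFDerivAt (fun y => fderiv ℝ n y v) _ x := fun v =>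
    (H.hasFDerivAt_fderiv hx).clm_apply (hasFDerivAt_const v x)
  have N : ∀ v, HasFDerivAt (fun y => ⟪n y, v⟫) _ x := fun v =>
    (H.hasFDerivAt hx).inner ℝ (hasFDerivAt_const v x)
  have key : ∀ u v, ⟪n x, v⟫ = 0 →
      fderiv ℝ (fderiv ℝ (fun y => ⟪fderiv ℝ n y w, z⟫)) x u v
      = -(⟪fderiv ℝ n x u, v⟫ * ⟪fderiv ℝ n x w, fderiv ℝ n x z⟫
        + ⟪fderiv ℝ n x u, w⟫ * ⟪fderiv ℝ n x v, fderiv ℝ n x z⟫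
        + ⟪fderiv ℝ n x u, z⟫ * ⟪fderiv ℝ n x v, fderiv ℝ n x w⟫) := by
    intro u v hv
    have e1 := (hd.hasFDerivAt.clm_apply (hasFDerivAt_const v x)).fderiv
    have e2 := (((((N v).mul ((A w).inner ℝ (A z))).add ((N w).mul ((A v).inner ℝ (A z)))).add
      ((N z).mul ((A v).inner ℝ (A w)))).neg).fderiv
    have e3 := Filter.EventuallyEq.fderiv_eq (𝕜 := ℝ) (formula v w z)
    have e4 := congrArg (fun L => L u) (e1.symm.trans (e3.trans e2))
    simp [fderivInnerCLM_apply, hv, hw, hz] at e4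
    rw [e4]; ring
  have e := _root_.second_fderiv_symm (hsm.contDiffAt hxU) u v
  rw [key u v hv, key v u hu, H.symm hx u v] at e
  linarith

end SteadyFlow

lemma StraightStreamlinesSteady.exists_steadyFlow {U : Set E3} (hU : IsOpen U) {V : E3 → E3}
    {p : E3 → ℝ} {n : E3 → E3} (hEuler : SolvesEulerSteady U V p)
    (hstream : StraightStreamlinesSteady U V n)
    (hrank : ∀ x ∈ U, LinearMap.rank (fderiv ℝ n x : E3 →ₗ[ℝ] E3) = 2) :
    ∃ f, SteadyFlow U n f p ∧ ∀ x ∈ U, V x = f x • n x := by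
  obtain ⟨-, hp, heq⟩ := hEuler
  obtain ⟨hn, hunit, ⟨f, hf, hfV⟩, hgeo⟩ := hstream
  have R : RankTwoField U n := ⟨hU, hn, hunit, hgeo, hrank⟩
  have dV : ∀ x ∈ U, fderiv ℝ V x = f x • fderiv ℝ n x + (fderiv ℝ f x).smulRight (n x) := by
    intro x hx
    rw [fderiv_congr_of_eqOn hU (fun y hy => (hfV y hy).2) hx]
    exact (((hf.contDiffAt (hU.mem_nhds hx)).differentiableAt (by simp)).hasFDerivAt.smul
      (R.hasFDerivAt hx)).fderiv
  have hspeed : ∀ x ∈ U, fderiv ℝ f x (n x) = - (f x * tau n x) := by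
    intro x hx
    have h1 : trC (fderiv ℝ V x) = 0 := (heq x hx).2
    have h2 : trC ((fderiv ℝ f x).smulRight (n x)) = fderiv ℝ f x (n x) :=
      LinearMap.trace_smulRight (fderiv ℝ f x : E3 →ₗ[ℝ] ℝ) (n x)
    rw [dV x hx, map_add, map_smul, h2, smul_eq_mul] at h1
    exact eq_neg_of_add_eq_zero_right h1
  refine ⟨f, ⟨R, hf, hp, fun x hx => (hfV x hx).1, hspeed, fun x hx v => ?_⟩,
    fun x hx => (hfV x hx).2⟩
  have h1 := (heq x hx).1
  rw [dV x hx, (hfV x hx).2] at h1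
  simp [hgeo x hx, hspeed x hx] at h1
  rw [← inner_gradient_left, ← h1]
  simp [inner_smul_left]
  ring

namespace SteadyFlow

variable {U : Set E3} {n : E3 → E3} {f p : E3 → ℝ} (H : SteadyFlow U n f p)
include H

lemma tau_ne_zero {x : E3} (hx : x ∈ U) : tau n x ≠ 0 := by
  intro h
  have h1 := H.umbilic hx
  have h2 := H.det_ne_zero hx
  rw [h] at h1 h2
  apply h2
  linarith

lemma hasFDerivAt_tau {x : E3} (hx : x ∈ U) :
    HasFDerivAt (tau n) (-(tau n x ^ 2 / 2) • innerSL ℝ (n x)) x := by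
  have h := ((H.smooth_tau.contDiffAt (H.isOpen.mem_nhds hx)).differentiableAt
    (by simp)).hasFDerivAt
  refine h.congr_fderiv ?_
  ext1 v
  rw [H.fderiv_tau_eq hx]
  have := H.umbilic hx
  simp
  left
  linarith

lemma hasFDerivAt_speed {x : E3} (hx : x ∈ U) :
    HasFDerivAt f (-(f x * tau n x) • innerSL ℝ (n x)) x := by
  have h := ((H.smooth_speed.contDiffAt (H.isOpen.mem_nhds hx)).differentiableAt
    (by simp)).hasFDerivAt
  refine h.congr_fderiv ?_
  ext1 v
  rw [H.fderiv_speed_eq hx]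
  simp

lemma hasFDerivAt_pressure {x : E3} (hx : x ∈ U) :
    HasFDerivAt p ((f x ^ 2 * tau n x) • innerSL ℝ (n x)) x := by
  have h := ((H.smooth_pressure.contDiffAt (H.isOpen.mem_nhds hx)).differentiableAt
    (by simp)).hasFDerivAt
  refine h.congr_fderiv ?_
  ext1 v
  rw [H.fderiv_pressure x hx]
  simp

lemma eq_const {F : Type*} [NormedAddCommGroup F] [NormedSpace ℝ F] (hconn : IsPreconnected U)
    {g : E3 → F} (hg : ∀ x ∈ U, HasFDerivAt g (0 : E3 →L[ℝ] F) x) : ∃ c, ∀ x ∈ U, g x = c :=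
  H.isOpen.exists_is_const_of_fderiv_eq_zero (𝕜 := ℝ) hconn
    (fun x hx => (hg x hx).differentiableAt.differentiableWithinAt) (fun x hx => (hg x hx).fderiv)

lemma exists_center (hconn : IsPreconnected U) :
    ∃ c, ∀ x ∈ U, x - c = (2 / tau n x) • n x := by
  obtain ⟨c, hc⟩ := H.eq_const hconn (g := fun x => x - (2 * (tau n x)⁻¹) • n x) (fun x hx => by
    have hτ := H.tau_ne_zero hx
    have h1 := (hasDerivAt_inv hτ).comp_hasFDerivAt x (H.hasFDerivAt_tau hx)
    have h2 := (hasFDerivAt_id x).sub ((h1.const_mul 2).smul (H.hasFDerivAt hx))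
    refine h2.congr_fderiv ?_
    ext1 v
    simp only [sub_apply, add_apply, smul_apply,
      ContinuousLinearMap.smulRight_apply, zero_apply, Function.comp_apply]
    rw [eq_smul_of_umbilic (H.unit x hx) (H.geodesic x hx) (H.inner_fderiv hx) (H.symm hx)
      (H.umbilic hx) v]
    change v - ((2 * (tau n x)⁻¹) • (tau n x / 2) • (v - ⟪n x, v⟫ • n x) + _) = 0
    rw [smul_smul, show 2 * (tau n x)⁻¹ * (tau n x / 2) = 1 by field_simp]
    simp only [innerSL_apply_apply, smul_eq_mul]
    rw [show 2 * (-(tau n x ^ 2)⁻¹ * (-(tau n x ^ 2 / 2) * ⟪n x, v⟫)) = ⟪n x, v⟫ by field_simp]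
    module)
  refine ⟨c, fun x hx => ?_⟩
  rw [← hc x hx, div_eq_mul_inv]
  abel

lemma exists_speed_eq (hconn : IsPreconnected U) : ∃ C, ∀ x ∈ U, f x = C * tau n x ^ 2 := by
  obtain ⟨C, hC⟩ := H.eq_const hconn (g := fun x => f x * ((tau n x ^ 2)⁻¹)) (fun x hx => by
    have hτ := H.tau_ne_zero hx
    have h1 := (hasDerivAt_inv (pow_ne_zero 2 hτ)).comp_hasFDerivAt x ((H.hasFDerivAt_tau hx).pow 2)
    refine ((H.hasFDerivAt_speed hx).mul h1).congr_fderiv ?_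
    ext1 v
    simp
    field_simp
    ring)
  refine ⟨C, fun x hx => ?_⟩
  rw [← hC x hx, inv_mul_cancel_right₀ (pow_ne_zero 2 (H.tau_ne_zero hx))]

lemma exists_pressure_eq (hconn : IsPreconnected U) {C : ℝ} (hC : ∀ x ∈ U, f x = C * tau n x ^ 2) :
    ∃ p₀, ∀ x ∈ U, p x = p₀ - C ^ 2 * tau n x ^ 4 / 2 := by
  obtain ⟨p₀, hp₀⟩ := H.eq_const hconn (g := fun x => p x + C ^ 2 / 2 * tau n x ^ 4)
    (fun x hx => by
      refine ((H.hasFDerivAt_pressure hx).add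
        (((H.hasFDerivAt_tau hx).pow 4).const_mul (C ^ 2 / 2))).congr_fderiv ?_
      ext1 v
      simp [hC x hx]
      ring)
  refine ⟨p₀, fun x hx => ?_⟩
  rw [← hp₀ x hx]
  ring

end SteadyFlow

/-- Steady rank two flows are point sources: the streamlines are the normals
to a round sphere. -/
theorem steady_rank_two_is_point_source
    (U : Set E3) (hU : IsOpen U) (hne : U.Nonempty) (hconn : IsConnected U)
    (V : E3 → E3) (p : E3 → ℝ) (n : E3 → E3)
    (hEuler : SolvesEulerSteady U V p)
    (hstream : StraightStreamlinesSteady U V n)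
    (hrank : ∀ x ∈ U, LinearMap.rank (fderiv ℝ n x : E3 →ₗ[ℝ] E3) = 2) :
    ∃ (c : E3) (H₀ p₀ : ℝ), ∀ x ∈ U,
      V x = (H₀ / ‖x - c‖ ^ 3) • (x - c) ∧
      p x = p₀ - H₀ ^ 2 / (2 * ‖x - c‖ ^ 4) := by
  obtain ⟨f, H, hV⟩ := hstream.exists_steadyFlow hU hEuler hrank
  have hpre := hconn.isPreconnected
  obtain ⟨c, hc⟩ := H.exists_center hpre
  obtain ⟨C, hC⟩ := H.exists_speed_eq hpre
  obtain ⟨p₀, hp₀⟩ := H.exists_pressure_eq hpre hC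
  have hτr : ∀ x ∈ U, (tau n x * ‖x - c‖ / 2) ^ 2 = 1 := by
    intro x hx
    have hτ := H.tau_ne_zero hx
    rw [hc x hx, norm_smul, H.unit x hx, mul_one, Real.norm_eq_abs, div_pow, mul_pow, sq_abs]
    field_simp
  obtain ⟨ε, hε, hετ⟩ : ∃ ε : ℝ, ε ^ 2 = 1 ∧ ∀ x ∈ U, tau n x * ‖x - c‖ / 2 = ε := by
    have hcont : ContinuousOn (fun x => tau n x * ‖x - c‖ / 2) U := by
      have := H.smooth_tau.continuousOn
      fun_prop
    rcases hpre.eq_one_or_eq_neg_one_of_sq_eq hcont hτr with h | h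
    · exact ⟨1, by norm_num, fun x hx => h hx⟩
    · exact ⟨-1, by norm_num, fun x hx => h hx⟩
  refine ⟨c, 4 * C * ε, p₀, fun x hx => ?_⟩
  have hτ := H.tau_ne_zero hx
  have hr : ‖x - c‖ ≠ 0 := by
    intro h
    have := hτr x hx
    rw [h] at this
    norm_num at this
  have hτ' : tau n x = 2 * ε / ‖x - c‖ := by
    rw [← hετ x hx]; field_simp
  have hε4 : ε ^ 4 = 1 := by
    rw [show ε ^ 4 = (ε ^ 2) ^ 2 by ring, hε, one_pow]
  constructor
  · have hnx : n x = (tau n x / 2) • (x - c) := by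
      rw [hc x hx, smul_smul, show tau n x / 2 * (2 / tau n x) = 1 by field_simp, one_smul]
    rw [hV x hx, hC x hx, hnx, smul_smul, hτ']
    congr 1
    field_simp
    linear_combination 4 * C * ε * hε
  · rw [hp₀ x hx, hτ']
    congr 1
    field_simp
    rw [hε, hε4]
    ring
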